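/- arXiv:1912.03853 — 6 statements merged into one kernel-verified Lean document; each statement's English description precedes it below -/
import Mathlib

section
/- Let Φ be a real-valued random variable on a probability space whose distribution is atomless, with CDF F(φ) = P(Φ ≤ φ), and let R_S > 0. Define the random variable Δ by: Δ = 1 if Φ ≥ 2^{2R_S}; Δ = (log₂ Φ)/(2R_S) if 1 < Φ < 2^{2R_S}; Δ = 0 if Φ ≤ 1. Then the average fractional equivocation satisfies E[Δ] = 1 − (1/(2 R_S ln 2)) · ∫₁^{2^{2R_S}} F(φ)/φ dφ. -/
open MeasureTheory Set in
theorem setIntegral_indicator_Ici_inv (b x : ℝ) :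
    ∫ t in Ioc 1 b, (Ici x).indicator (fun t : ℝ => t⁻¹) t =
      Real.log b - Real.log (min b (max 1 x)) := by
  have hae : (Ici x).indicator (fun t : ℝ => t⁻¹)
      =ᵐ[volume.restrict (Ioc 1 b)] (Ioi x).indicator (fun t : ℝ => t⁻¹) :=
    ae_restrict_of_ae (indicator_ae_eq_of_ae_eq_set Ioi_ae_eq_Ici.symm)
  rw [integral_congr_ae hae, setIntegral_indicator measurableSet_Ioi, Ioc_inter_Ioi]
  rcases le_total (max 1 x) b with h | h
  · have h0 : 0 < max 1 x := lt_max_of_lt_left one_pos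
    rw [← intervalIntegral.integral_of_le h, integral_inv_of_pos h0 (h0.trans_le h),
      Real.log_div (h0.trans_le h).ne' h0.ne', min_eq_right h]
  · rw [Ioc_eq_empty (not_lt.mpr h), min_eq_left h]
    simp

open MeasureTheory Set in
theorem integrable_indicator_le_inv {Ω : Type*} [MeasurableSpace Ω] (μ : Measure Ω)
    [IsFiniteMeasure μ] {Φ : Ω → ℝ} (hΦ : Measurable Φ) (b : ℝ) :
    Integrable (Function.uncurry fun ω t => (Ici (Φ ω)).indicator (fun t : ℝ => t⁻¹) t)
      (μ.prod (volume.restrict (Ioc 1 b))) := by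
  have hs : MeasurableSet {p : Ω × ℝ | Φ p.1 ≤ p.2} :=
    measurableSet_le (hΦ.comp measurable_fst) measurable_snd
  have heq : (Function.uncurry fun ω t => (Ici (Φ ω)).indicator (fun t : ℝ => t⁻¹) t) =
      {p : Ω × ℝ | Φ p.1 ≤ p.2}.indicator fun p => p.2⁻¹ := by
    ext ⟨ω, t⟩
    simp [indicator_apply]
  have hinv : Integrable (fun t : ℝ => t⁻¹) (volume.restrict (Ioc 1 b)) := by
    refine Integrable.of_bound measurable_inv.aestronglyMeasurable 1 ?_
    filter_upwards [ae_restrict_mem measurableSet_Ioc] with t ht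
    rw [Real.norm_of_nonneg (inv_nonneg.mpr (zero_le_one.trans ht.1.le))]
    exact inv_le_one_of_one_le₀ ht.1.le
  rw [heq]
  exact (hinv.comp_snd μ).indicator hs

open MeasureTheory Set in
theorem intervalIntegral_cdf_div {Ω : Type*} [MeasurableSpace Ω] (μ : Measure Ω)
    [IsFiniteMeasure μ] {Φ : Ω → ℝ} (hΦ : Measurable Φ) {b : ℝ} (hb : 1 ≤ b) :
    ∫ t in (1 : ℝ)..b, (μ {ω | Φ ω ≤ t}).toReal / t =
      ∫ ω, (Real.log b - Real.log (min b (max 1 (Φ ω)))) ∂μ := by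
  simp_rw [← setIntegral_indicator_Ici_inv]
  rw [integral_integral_swap (integrable_indicator_le_inv μ hΦ b),
    intervalIntegral.integral_of_le hb]
  congr 1
  ext t
  have heq : (fun ω => (Ici (Φ ω)).indicator (fun t : ℝ => t⁻¹) t) =
      {ω | Φ ω ≤ t}.indicator fun _ => t⁻¹ := by
    ext ω
    simp [indicator_apply]
  rw [heq, integral_indicator_const _ (measurableSet_le hΦ measurable_const), smul_eq_mul,
    div_eq_mul_inv, measureReal_def]

open MeasureTheory in
theorem average_fractional_equivocation {Ω : Type*} [MeasurableSpace Ω]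
    (μ : Measure Ω) [IsProbabilityMeasure μ]
    (Φ : Ω → ℝ) (hΦ : Measurable Φ)
    (hatomless : ∀ a : ℝ, μ {ω | Φ ω = a} = 0)
    (RS : ℝ) (hRS : 0 < RS) :
    (∫ ω, (if (2:ℝ) ^ (2 * RS) ≤ Φ ω then (1:ℝ)
           else if 1 < Φ ω then Real.logb 2 (Φ ω) / (2 * RS)
           else 0) ∂μ)
      = 1 - (1 / (2 * RS * Real.log 2)) *
          ∫ φ in (1:ℝ)..(2:ℝ) ^ (2 * RS), (μ {ω | Φ ω ≤ φ}).toReal / φ := by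
  have hb : (1 : ℝ) ≤ 2 ^ (2 * RS) := Real.one_le_rpow one_le_two (by positivity)
  have hlog : Real.log ((2 : ℝ) ^ (2 * RS)) = 2 * RS * Real.log 2 := Real.log_rpow two_pos _
  have hlog2 : 0 < Real.log 2 := Real.log_pos one_lt_two
  rw [intervalIntegral_cdf_div μ hΦ hb]
  have hint : Integrable (fun ω => Real.log ((2 : ℝ) ^ (2 * RS)) -
      Real.log (min (2 ^ (2 * RS)) (max 1 (Φ ω)))) μ := by
    simp_rw [← setIntegral_indicator_Ici_inv]
    exact (integrable_indicator_le_inv μ hΦ _).integral_prod_left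
  have hsub := integral_sub (integrable_const (1 : ℝ))
    (hint.const_mul (1 / (2 * RS * Real.log 2)))
  rw [integral_const, probReal_univ, one_smul, integral_const_mul] at hsub
  rw [← hsub]
  congr 1
  ext ω
  split_ifs with h₁ h₂
  · rw [max_eq_right (hb.trans h₁), min_eq_left h₁]
    simp
  · rw [max_eq_right h₂.le, min_eq_right (not_le.mp h₁).le, hlog, Real.logb]
    field_simp
    ring
  · rw [max_eq_left (not_lt.mp h₂), min_eq_right hb, hlog, Real.log_one]
    field_simp
    ring
end

section
/- Let Φ be a real-valued random variable on a probability space whose distribution is atomless, with CDF F(φ) = P(Φ ≤ φ), and let R_S > 0. Define the random variable Δ by: Δ = 1 if Φ ≥ 2^{2R_S}; Δ = (log₂ Φ)/(2R_S) if 1 < Φ < 2^{2R_S}; Δ = 0 if Φ ≤ 1. Then the average information leakage rate R_L = (1 − E[Δ])·R_S satisfies R_L = (1/(2 ln 2)) · ∫₁^{2^{2R_S}} F(φ)/φ dφ. -/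
open MeasureTheory Set in
/-- The logarithmic measure of the part of `(1, b]` lying at or above `x`. -/
theorem integral_ite_le_inv (x b : ℝ) (hb : 1 < b) :
    (∫ t in (1:ℝ)..b, if x ≤ t then t⁻¹ else 0)
      = if b ≤ x then 0 else if 1 < x then Real.log b - Real.log x else Real.log b := by
  have key : (∫ t in (1:ℝ)..b, if x ≤ t then t⁻¹ else 0)
      = ∫ t in Ioc 1 b ∩ Ici x, t⁻¹ := by
    rw [intervalIntegral.integral_of_le hb.le, ← setIntegral_indicator measurableSet_Ici]
    rfl
  rw [key]
  split_ifs with h₁ h₂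
  · refine setIntegral_measure_zero _ (measure_mono_null (t := {b}) ?_ (measure_singleton b))
    rintro t ⟨⟨-, ht⟩, hxt⟩
    exact le_antisymm ht (h₁.trans hxt)
  · push Not at h₁
    have hs : Ioc 1 b ∩ Ici x = Icc x b := by
      ext t
      simp only [mem_inter_iff, mem_Ioc, mem_Ici, mem_Icc]
      exact ⟨fun h ↦ ⟨h.2, h.1.2⟩, fun h ↦ ⟨⟨h₂.trans_le h.1, h.2⟩, h.1⟩⟩
    have hx : 0 < x := by linarith
    have hb₀ : 0 < b := by linarith
    rw [hs, integral_Icc_eq_integral_Ioc, ← intervalIntegral.integral_of_le h₁.le,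
      integral_inv_of_pos hx hb₀, Real.log_div hb₀.ne' hx.ne']
  · push Not at h₂
    have hs : Ioc 1 b ∩ Ici x = Ioc 1 b :=
      inter_eq_left.2 fun t ht ↦ h₂.trans ht.1.le
    rw [hs, ← intervalIntegral.integral_of_le hb.le,
      integral_inv_of_pos one_pos (by linarith), div_one]

open MeasureTheory Set in
theorem integrable_ite_le_inv {Ω : Type*} [MeasurableSpace Ω]
    (μ : Measure Ω) [IsFiniteMeasure μ] {Φ : Ω → ℝ} (hΦ : Measurable Φ) (b : ℝ) :
    Integrable (Function.uncurry fun (t : ℝ) (ω : Ω) ↦ if Φ ω ≤ t then t⁻¹ else 0)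
      ((volume.restrict (Ioc 1 b)).prod μ) := by
  have hm : Measurable (Function.uncurry fun (t : ℝ) (ω : Ω) ↦ if Φ ω ≤ t then t⁻¹ else 0) :=
    Measurable.ite (measurableSet_le (hΦ.comp measurable_snd) measurable_fst)
      measurable_fst.inv measurable_const
  refine Integrable.of_bound hm.aestronglyMeasurable 1 ?_
  have hfst : ∀ᵐ p ∂((volume.restrict (Ioc (1:ℝ) b)).prod μ), p.1 ∈ Ioc 1 b :=
    Measure.quasiMeasurePreserving_fst.ae (ae_restrict_mem measurableSet_Ioc)
  filter_upwards [hfst] with ⟨t, ω⟩ ht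
  have ht₁ : 1 ≤ t := ht.1.le
  simp only [Function.uncurry_apply_pair]
  split_ifs
  · rw [Real.norm_of_nonneg (by positivity)]
    exact inv_le_one_of_one_le₀ ht₁
  · simp

open MeasureTheory in
theorem average_information_leakage_rate {Ω : Type*} [MeasurableSpace Ω]
    (μ : Measure Ω) [IsProbabilityMeasure μ]
    (Φ : Ω → ℝ) (hΦ : Measurable Φ)
    (hatomless : ∀ a : ℝ, μ {ω | Φ ω = a} = 0)
    (RS : ℝ) (hRS : 0 < RS) :
    (1 - ∫ ω, (if (2:ℝ) ^ (2 * RS) ≤ Φ ω then (1:ℝ)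
               else if 1 < Φ ω then Real.logb 2 (Φ ω) / (2 * RS)
               else 0) ∂μ) * RS
      = (1 / (2 * Real.log 2)) *
          ∫ φ in (1:ℝ)..(2:ℝ) ^ (2 * RS), (μ {ω | Φ ω ≤ φ}).toReal / φ := by
  have hb : (1:ℝ) < 2 ^ (2 * RS) := Real.one_lt_rpow (by norm_num) (by positivity)
  have hlogb : Real.log ((2:ℝ) ^ (2 * RS)) = 2 * RS * Real.log 2 :=
    Real.log_rpow two_pos _
  have hlog : 0 < Real.log 2 := Real.log_pos one_lt_two
  have hprod := integrable_ite_le_inv μ hΦ ((2:ℝ) ^ (2 * RS))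
  generalize (2:ℝ) ^ (2 * RS) = b at *
  have hcdf (t : ℝ) : (μ {ω | Φ ω ≤ t}).toReal / t = ∫ ω, (if Φ ω ≤ t then t⁻¹ else 0) ∂μ := by
    have h := integral_indicator_const (μ := μ) t⁻¹ (measurableSet_le hΦ (measurable_const (a := t)))
    rw [smul_eq_mul] at h
    exact h.symm
  have hleak (ω : Ω) : (if b ≤ Φ ω then (1:ℝ)
      else if 1 < Φ ω then Real.logb 2 (Φ ω) / (2 * RS) else 0)
      = 1 - (2 * RS * Real.log 2)⁻¹ * ∫ t in (1:ℝ)..b, if Φ ω ≤ t then t⁻¹ else 0 := by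
    rw [integral_ite_le_inv _ _ hb, hlogb]
    split_ifs
    · simp
    · rw [Real.logb]
      field_simp
      ring
    · field_simp
      ring
  have hswap : ∫ t in (1:ℝ)..b, (∫ ω, (if Φ ω ≤ t then t⁻¹ else 0) ∂μ)
      = ∫ ω, (∫ t in (1:ℝ)..b, if Φ ω ≤ t then t⁻¹ else 0) ∂μ := by
    simp_rw [intervalIntegral.integral_of_le hb.le]
    exact integral_integral_swap hprod
  have hinner : Integrable (fun ω ↦ ∫ t in (1:ℝ)..b, if Φ ω ≤ t then t⁻¹ else 0) μ := by
    simp_rw [intervalIntegral.integral_of_le hb.le]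
    exact hprod.integral_prod_right
  simp_rw [hcdf, hleak]
  rw [hswap, integral_sub (integrable_const _) (hinner.const_mul _), integral_const_mul]
  simp only [integral_const, probReal_univ, smul_eq_mul, mul_one]
  field_simp
  ring
end

section
/- Let X and Y be independent real random variables on a probability space, where X is exponentially distributed with mean Ω₁ > 0 and Y is exponentially distributed with mean Ω₂ > 0, and let c > 0 and k > 0. Then P(X ≤ c and Y > kX) = (Ω₂/(Ω₂ + kΩ₁)) · (1 − exp(−c·(1/Ω₁ + k/Ω₂))). -/
open MeasureTheory ProbabilityTheory in
theorem map_eq_expMeasure_of_tail {α : Type*} [MeasurableSpace α]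
    (μ : Measure α) [IsProbabilityMeasure μ] {X : α → ℝ} (hX : Measurable X)
    {Ω : ℝ} (hΩ : 0 < Ω) (hnn : ∀ᵐ ω ∂μ, 0 ≤ X ω)
    (hexp : ∀ t : ℝ, 0 ≤ t → μ {ω | t < X ω} = ENNReal.ofReal (Real.exp (-t / Ω))) :
    μ.map X = expMeasure Ω⁻¹ := by
  have hr : 0 < Ω⁻¹ := inv_pos.mpr hΩ
  have := isProbabilityMeasure_expMeasure hr
  have := Measure.isProbabilityMeasure_map (μ := μ) hX.aemeasurable
  refine Measure.eq_of_cdf _ _ (StieltjesFunction.ext fun t => ?_)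
  rw [cdf_expMeasure_eq hr, cdf_eq_real, map_measureReal_apply hX measurableSet_Iic]
  split_ifs with ht
  · have hcompl : X ⁻¹' Set.Iic t = {ω | t < X ω}ᶜ := by ext; simp
    rw [hcompl, probReal_compl_eq_one_sub (measurableSet_lt measurable_const hX),
      Measure.real, hexp t ht, ENNReal.toReal_ofReal (Real.exp_nonneg _)]
    congr 2
    field_simp
  · rw [measureReal_eq_zero_iff]
    refine measure_mono_null (fun ω hω => ?_) (ae_iff.mp hnn)
    simp only [Set.mem_preimage, Set.mem_Iic, Set.mem_ofPred_eq, not_le] at *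
    exact hω.trans_lt ht

open ProbabilityTheory in
theorem exponentialPDF_mul_exp {r a x : ℝ} (hr : 0 < r) (ha : 0 < a) (hx : 0 ≤ x) :
    exponentialPDF r x * ENNReal.ofReal (Real.exp (-(a * x)))
      = ENNReal.ofReal (r / (r + a)) * exponentialPDF (r + a) x := by
  rw [exponentialPDF_of_nonneg hx, exponentialPDF_of_nonneg hx,
    ← ENNReal.ofReal_mul (by positivity), ← ENNReal.ofReal_mul (by positivity)]
  congr 1
  rw [mul_assoc, ← Real.exp_add, ← mul_assoc, div_mul_cancel₀ _ (by positivity)]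
  congr 2
  ring

open MeasureTheory ProbabilityTheory in
theorem exp_joint_prob_T1 {α : Type*} [MeasurableSpace α]
    (μ : Measure α) [IsProbabilityMeasure μ]
    (X Y : α → ℝ) (hX : Measurable X) (hY : Measurable Y)
    (Ω₁ Ω₂ : ℝ) (hΩ₁ : 0 < Ω₁) (hΩ₂ : 0 < Ω₂)
    (hXnn : ∀ᵐ ω ∂μ, 0 ≤ X ω) (hYnn : ∀ᵐ ω ∂μ, 0 ≤ Y ω)
    (hXexp : ∀ t : ℝ, 0 ≤ t → μ {ω | t < X ω} = ENNReal.ofReal (Real.exp (-t / Ω₁)))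
    (hYexp : ∀ t : ℝ, 0 ≤ t → μ {ω | t < Y ω} = ENNReal.ofReal (Real.exp (-t / Ω₂)))
    (hindep : IndepFun X Y μ)
    (c k : ℝ) (hc : 0 < c) (hk : 0 < k) :
    μ {ω | X ω ≤ c ∧ k * X ω < Y ω}
      = ENNReal.ofReal
          ((Ω₂ / (Ω₂ + k * Ω₁)) * (1 - Real.exp (-c * (1 / Ω₁ + k / Ω₂)))) := by
  have hr : 0 < Ω₁⁻¹ := inv_pos.mpr hΩ₁
  have ha : 0 < k / Ω₂ := div_pos hk hΩ₂
  have hs : 0 < Ω₁⁻¹ + k / Ω₂ := add_pos hr ha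
  have hpdf (r : ℝ) : Measurable (exponentialPDF r) :=
    (measurable_exponentialPDFReal r).ennreal_ofReal
  have := Measure.isProbabilityMeasure_map (μ := μ) hX.aemeasurable
  have := Measure.isProbabilityMeasure_map (μ := μ) hY.aemeasurable
  set S : Set (ℝ × ℝ) := {p | p.1 ≤ c ∧ k * p.1 < p.2} with hS
  have hSm : MeasurableSet S :=
    (measurableSet_le measurable_fst measurable_const).inter
      (measurableSet_lt (measurable_fst.const_mul k) measurable_snd)
  have hslice (x : ℝ) : exponentialPDF Ω₁⁻¹ x * μ.map Y (Prod.mk x ⁻¹' S)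
      = (Set.Iic c).indicator (fun x => ENNReal.ofReal (Ω₁⁻¹ / (Ω₁⁻¹ + k / Ω₂))
          * exponentialPDF (Ω₁⁻¹ + k / Ω₂) x) x := by
    by_cases hxc : x ≤ c
    · rw [Set.indicator_of_mem (Set.mem_Iic.mpr hxc)]
      rcases lt_or_ge x 0 with hx | hx
      · simp [exponentialPDF_of_neg hx]
      · rw [← exponentialPDF_mul_exp hr ha hx, Measure.map_apply hY (measurable_prodMk_left hSm)]
        have hpre : Y ⁻¹' (Prod.mk x ⁻¹' S) = {ω | k * x < Y ω} := by ext; simp [hS, hxc]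
        rw [hpre, hYexp _ (by positivity)]
        congr 3
        ring
    · have hempty : Prod.mk x ⁻¹' S = ∅ := by ext; simp [hS, hxc]
      rw [Set.indicator_of_notMem (by simpa using hxc), hempty, measure_empty, mul_zero]
  calc μ {ω | X ω ≤ c ∧ k * X ω < Y ω}
      = μ.map (fun ω => (X ω, Y ω)) S := by
        rw [Measure.map_apply (hX.prodMk hY) hSm]; rfl
    _ = ∫⁻ x, μ.map Y (Prod.mk x ⁻¹' S) ∂(expMeasure Ω₁⁻¹) := by
        rw [(indepFun_iff_map_prod_eq_prod_map_map hX.aemeasurable hY.aemeasurable).mp hindep,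
          Measure.prod_apply hSm, map_eq_expMeasure_of_tail μ hX hΩ₁ hXnn hXexp]
    _ = ∫⁻ x, exponentialPDF Ω₁⁻¹ x * μ.map Y (Prod.mk x ⁻¹' S) :=
        lintegral_withDensity_eq_lintegral_mul _ (hpdf _) (measurable_measure_prodMk_left hSm)
    _ = ENNReal.ofReal (Ω₁⁻¹ / (Ω₁⁻¹ + k / Ω₂))
          * ∫⁻ x in Set.Iic c, exponentialPDF (Ω₁⁻¹ + k / Ω₂) x := by
        rw [lintegral_congr hslice, lintegral_indicator measurableSet_Iic,
          lintegral_const_mul _ (hpdf _)]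
    _ = _ := by
        rw [lintegral_exponentialPDF_eq_antiDeriv hs, if_pos hc.le,
          ← ENNReal.ofReal_mul (by positivity)]
        congr 2
        · field_simp
        · congr 2
          ring
end

section
/- System parameters: total SNR γ_P > 0; power allocation factors η₁, η₂, η₃ > 0 with η₁+η₂+η₃ = 1; transmit SNRs γ_S = η₁γ_P, γ_R = η₂γ_P, γ_D = η₃γ_P; average channel gains Ω_SR, Ω_RD > 0; g_SR and g_RD are independent exponentially distributed random variables with means Ω_SR and Ω_RD. Fix φ > 1 and define: φ₂ = [φ(2γ_D² + 3γ_Dγ_R + γ_R²) − (γ_D+γ_R)²]/(2γ_Dγ_Rγ_S) + (1/2)·√([φ²(2γ_D²+3γ_Dγ_R+γ_R²)² − 2φ(2γ_D²+γ_Dγ_R+γ_R²)(γ_D+γ_R)² + (γ_D²−γ_R²)²]/(γ_D²γ_R²γ_S²)); φ₃(x) = (γ_Dφ − γ_D − γ_R)/(2γ_Dγ_R) + (1/2)·√((γ_D²φ² + (γ_D−γ_R)² − 2γ_Dφ(γ_D − γ_R − 2γ_Rγ_S x))/(γ_D²γ_R²)); φ₄ = η₂² + η₃²(φ−1)² + 2η₂η₃(2γ_Pη₁φ₂φ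 + φ − 1); and ψ₆ = [2η₂Ω_RD(η₁φΩ_SR + η₃(φ−1)Ω_RD) + η₂²Ω_RD²]/(4γ_Pη₁η₂η₃φΩ_RD²Ω_SR) + (η₁φΩ_SR + η₃(1−φ)Ω_RD)²/(4γ_Pη₁η₂η₃φΩ_RD²Ω_SR). Then P(g_SR > φ₂ and g_RD < φ₃(g_SR)) = (√π·η₁φΩ_SR·e^{ψ₆}/(2Ω_RD√(γ_Pη₁η₂η₃φΩ_SR))) · erfc((η₁φΩ_SR + Ω_RD√φ₄)/(2Ω_RD√(γ_Pη₁η₂η₃φΩ_SR))) + e^{−φ₂/Ω_SR}·(1 − exp((η₂ − η₃φ + η₃ − √φ₄)/(2γ_Pη₂η₃Ω_RD))). -/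
open Real in
/-- The complementary error function `erfc z = (2/√π) ∫_z^∞ e^{-t²} dt`. -/
noncomputable def erfc (z : ℝ) : ℝ :=
  (2 / Real.sqrt π) * ∫ t in Set.Ioi z, Real.exp (-t ^ 2)

open MeasureTheory ProbabilityTheory Real in
theorem integrable_exp_neg_sq_affine {a : ℝ} (ha : a ≠ 0) (b : ℝ) :
    Integrable fun y : ℝ => Real.exp (-(a * y + b) ^ 2) := by
  have h := integrable_exp_neg_mul_sq (b := 1) one_pos
  simpa using (h.comp_add_right b).comp_mul_left' ha

open MeasureTheory ProbabilityTheory Real in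
theorem integral_Ioi_exp_neg_sq_affine {a : ℝ} (ha : 0 < a) (b y₀ : ℝ) :
    ∫ y in Set.Ioi y₀, Real.exp (-(a * y + b) ^ 2) =
      Real.sqrt π / (2 * a) * erfc (a * y₀ + b) := by
  have hshift : ∫ t in Set.Ioi (a * y₀), Real.exp (-(t + b) ^ 2) =
      ∫ t in Set.Ioi (a * y₀ + b), Real.exp (-t ^ 2) := by
    have h := (measurePreserving_add_right (volume : Measure ℝ) b).setIntegral_preimage_emb
      (measurableEmbedding_addRight b) (fun t => Real.exp (-t ^ 2)) (Set.Ioi (a * y₀ + b))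
    simpa using h
  rw [integral_comp_mul_left_Ioi (fun t => Real.exp (-(t + b) ^ 2)) y₀ ha, hshift, erfc,
    smul_eq_mul]
  have : Real.sqrt π ≠ 0 := (Real.sqrt_pos.2 Real.pi_pos).ne'
  field_simp

open MeasureTheory ProbabilityTheory Real in
/-- A nonnegative random variable with exponential tail of mean `m` has law `expMeasure m⁻¹`. -/
theorem map_eq_expMeasure {α : Type*} [MeasurableSpace α] {μ : Measure α} [IsProbabilityMeasure μ]
    {Y : α → ℝ} (hY : Measurable Y) {m : ℝ} (hm : 0 < m) (hnn : ∀ᵐ ω ∂μ, 0 ≤ Y ω)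
    (htail : ∀ t : ℝ, 0 ≤ t → μ {ω | t < Y ω} = ENNReal.ofReal (Real.exp (-t / m))) :
    μ.map Y = expMeasure m⁻¹ := by
  have hprob : IsProbabilityMeasure (μ.map Y) := Measure.isProbabilityMeasure_map hY.aemeasurable
  have hexp := isProbabilityMeasure_expMeasure (inv_pos.2 hm)
  refine Measure.eq_of_cdf _ _ ?_
  ext x
  rw [cdf_expMeasure_eq (inv_pos.2 hm), cdf_eq_real, map_measureReal_apply hY measurableSet_Iic]
  split_ifs with hx
  · have hcompl : Y ⁻¹' Set.Iic x = {ω | x < Y ω}ᶜ := by ext ω; simp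
    rw [hcompl, probReal_compl_eq_one_sub (measurableSet_lt measurable_const hY), measureReal_def,
      htail x hx, ENNReal.toReal_ofReal (Real.exp_pos _).le]
    congr 2
    field_simp
  · rw [measureReal_def, measure_eq_zero_iff_ae_notMem.2, ENNReal.toReal_zero]
    filter_upwards [hnn] with ω hω hle
    exact hx (hω.trans hle)

open MeasureTheory ProbabilityTheory Real in
/-- If `X` and `Y` are independent exponential variables and the exponent `q y / mX + y / mY` is
a quadratic polynomial in `y`, then `P(Y > y₀, X > q(Y))` is a value of `erfc`. -/
theorem measure_lt_and_comp_lt {α : Type*} [MeasurableSpace α] {μ : Measure α}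
    [IsProbabilityMeasure μ] {X Y : α → ℝ} (hX : Measurable X) (hY : Measurable Y)
    {mX mY : ℝ} (hmY : 0 < mY) (hYnn : ∀ᵐ ω ∂μ, 0 ≤ Y ω)
    (hXtail : ∀ t : ℝ, 0 ≤ t → μ {ω | t < X ω} = ENNReal.ofReal (Real.exp (-t / mX)))
    (hYtail : ∀ t : ℝ, 0 ≤ t → μ {ω | t < Y ω} = ENNReal.ofReal (Real.exp (-t / mY)))
    (hindep : IndepFun X Y μ) {q : ℝ → ℝ} (hq : Measurable q) {y₀ : ℝ} (hy₀ : 0 ≤ y₀)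
    (hqnn : ∀ y, y₀ < y → 0 ≤ q y) {a b C : ℝ} (ha : 0 < a)
    (hquad : ∀ y, q y / mX + y / mY = (a * y + b) ^ 2 - C) :
    μ.real {ω | y₀ < Y ω ∧ q (Y ω) < X ω} =
      Real.exp C * (Real.sqrt π / (2 * a * mY)) * erfc (a * y₀ + b) := by
  have hprobX : IsProbabilityMeasure (μ.map X) := Measure.isProbabilityMeasure_map hX.aemeasurable
  have hprobY : IsProbabilityMeasure (μ.map Y) := Measure.isProbabilityMeasure_map hY.aemeasurable
  have hS : MeasurableSet {p : ℝ × ℝ | y₀ < p.2 ∧ q p.2 < p.1} :=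
    (measurableSet_lt measurable_const measurable_snd).inter
      (measurableSet_lt (hq.comp measurable_snd) measurable_fst)
  have hprod : μ {ω | y₀ < Y ω ∧ q (Y ω) < X ω} =
      ((μ.map X).prod (μ.map Y)) {p : ℝ × ℝ | y₀ < p.2 ∧ q p.2 < p.1} := by
    rw [← hindep.map_prod_eq_prod_map_map hX.aemeasurable hY.aemeasurable,
      Measure.map_apply (hX.prodMk hY) hS]
    rfl
  have hslice : ∀ y, (μ.map X) ((fun x => (x, y)) ⁻¹' {p : ℝ × ℝ | y₀ < p.2 ∧ q p.2 < p.1}) =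
      (Set.Ioi y₀).indicator (fun y => ENNReal.ofReal (Real.exp (-q y / mX))) y := by
    intro y
    by_cases hy : y₀ < y
    · rw [Set.indicator_of_mem (Set.mem_Ioi.2 hy), ← hXtail _ (hqnn y hy),
        Measure.map_apply hX (measurable_prodMk_right hS)]
      simp [hy, Set.preimage]
    · rw [Set.indicator_of_notMem (by simpa using hy)]
      simp [hy]
  have hmeas : Measurable fun y => ENNReal.ofReal (Real.exp (-q y / mX)) :=
    ENNReal.measurable_ofReal.comp (Real.measurable_exp.comp (hq.neg.div_const mX))
  have hintegrand : ∀ y ∈ Set.Ioi y₀,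
      exponentialPDF mY⁻¹ y * ENNReal.ofReal (Real.exp (-q y / mX)) =
        ENNReal.ofReal (mY⁻¹ * Real.exp C * Real.exp (-(a * y + b) ^ 2)) := by
    intro y hy
    rw [exponentialPDF_of_nonneg (hy₀.trans (Set.mem_Ioi.1 hy).le),
      ← ENNReal.ofReal_mul (by positivity), mul_assoc, mul_assoc, ← Real.exp_add, ← Real.exp_add]
    congr 3
    have := hquad y
    rw [neg_div, ← div_eq_inv_mul]
    linarith
  have hint := (integrable_exp_neg_sq_affine ha.ne' b).const_mul (mY⁻¹ * Real.exp C)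
  rw [measureReal_def, hprod, Measure.prod_apply_symm hS, lintegral_congr hslice,
    lintegral_indicator measurableSet_Ioi, map_eq_expMeasure hY hmY hYnn hYtail]
  change (∫⁻ y in Set.Ioi y₀, _ ∂(volume.withDensity (exponentialPDF mY⁻¹))).toReal = _
  rw [setLIntegral_withDensity_eq_setLIntegral_mul _
    (by exact (measurable_exponentialPDFReal _).ennreal_ofReal) hmeas measurableSet_Ioi]
  simp only [Pi.mul_apply]
  rw [setLIntegral_congr_fun measurableSet_Ioi hintegrand,
    ← ofReal_integral_eq_lintegral_ofReal hint.integrableOn (ae_of_all _ fun y => by positivity),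
    ENNReal.toReal_ofReal (integral_nonneg fun y => by positivity), integral_const_mul,
    integral_Ioi_exp_neg_sq_affine ha]
  field_simp

open MeasureTheory ProbabilityTheory Real in
theorem T4_closed_form {α : Type*} [MeasurableSpace α]
    (μ : Measure α) [IsProbabilityMeasure μ]
    (gSR gRD : α → ℝ) (hgSR : Measurable gSR) (hgRD : Measurable gRD)
    (γP η₁ η₂ η₃ ΩSR ΩRD : ℝ)
    (hγP : 0 < γP) (hη₁ : 0 < η₁) (hη₂ : 0 < η₂) (hη₃ : 0 < η₃)
    (hsum : η₁ + η₂ + η₃ = 1) (hΩSR : 0 < ΩSR) (hΩRD : 0 < ΩRD)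
    (hSRnn : ∀ᵐ ω ∂μ, 0 ≤ gSR ω) (hRDnn : ∀ᵐ ω ∂μ, 0 ≤ gRD ω)
    (hSRexp : ∀ t : ℝ, 0 ≤ t → μ {ω | t < gSR ω} = ENNReal.ofReal (Real.exp (-t / ΩSR)))
    (hRDexp : ∀ t : ℝ, 0 ≤ t → μ {ω | t < gRD ω} = ENNReal.ofReal (Real.exp (-t / ΩRD)))
    (hindep : IndepFun gSR gRD μ)
    (φ : ℝ) (hφ : 1 < φ) :
    let γS := η₁ * γP
    let γR := η₂ * γP
    let γD := η₃ * γP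
    let φ₂ := (φ * (2 * γD ^ 2 + 3 * γD * γR + γR ^ 2) - (γD + γR) ^ 2) /
        (2 * γD * γR * γS) +
      (1/2) * Real.sqrt ((φ ^ 2 * (2 * γD ^ 2 + 3 * γD * γR + γR ^ 2) ^ 2 -
          2 * φ * (2 * γD ^ 2 + γD * γR + γR ^ 2) * (γD + γR) ^ 2 +
          (γD ^ 2 - γR ^ 2) ^ 2) / (γD ^ 2 * γR ^ 2 * γS ^ 2))
    let φ₃ : ℝ → ℝ := fun x => (γD * φ - γD - γR) / (2 * γD * γR) +
      (1/2) * Real.sqrt ((γD ^ 2 * φ ^ 2 + (γD - γR) ^ 2 -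
          2 * γD * φ * (γD - γR - 2 * γR * γS * x)) / (γD ^ 2 * γR ^ 2))
    let φ₄ := η₂ ^ 2 + η₃ ^ 2 * (φ - 1) ^ 2 +
      2 * η₂ * η₃ * (2 * γP * η₁ * φ₂ * φ + φ - 1)
    let ψ₆ := (2 * η₂ * ΩRD * (η₁ * φ * ΩSR + η₃ * (φ - 1) * ΩRD) + η₂ ^ 2 * ΩRD ^ 2) /
        (4 * γP * η₁ * η₂ * η₃ * φ * ΩRD ^ 2 * ΩSR) +
      (η₁ * φ * ΩSR + η₃ * (1 - φ) * ΩRD) ^ 2 /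
        (4 * γP * η₁ * η₂ * η₃ * φ * ΩRD ^ 2 * ΩSR)
    (μ {ω | φ₂ < gSR ω ∧ gRD ω < φ₃ (gSR ω)}).toReal
      = (Real.sqrt π * η₁ * φ * ΩSR * Real.exp ψ₆ /
            (2 * ΩRD * Real.sqrt (γP * η₁ * η₂ * η₃ * φ * ΩSR))) *
          erfc ((η₁ * φ * ΩSR + ΩRD * Real.sqrt φ₄) /
            (2 * ΩRD * Real.sqrt (γP * η₁ * η₂ * η₃ * φ * ΩSR))) +
        Real.exp (-φ₂ / ΩSR) *
          (1 - Real.exp ((η₂ - η₃ * φ + η₃ - Real.sqrt φ₄) /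
            (2 * γP * η₂ * η₃ * ΩRD))) := by
  intro γS γR γD φ₂ φ₃ φ₄ ψ₆
  set A := (η₂ + η₃ * (φ - 1)) ^ 2 with hA
  set B := 4 * γP * η₁ * η₂ * η₃ * φ with hB
  set c := η₃ * (φ - 1) - η₂ with hc
  set K := 2 * γP * η₂ * η₃ with hK
  set S := Real.sqrt (γP * η₁ * η₂ * η₃ * φ * ΩSR) with hS
  have hφ0 : 0 < φ := one_pos.trans hφ
  have hφ1 : 0 < φ - 1 := sub_pos.2 hφ
  have hBpos : 0 < B := by positivity
  have hKpos : 0 < K := by positivity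
  have hSpos : 0 < S := Real.sqrt_pos.2 (by positivity)
  have hSsq : S ^ 2 = γP * η₁ * η₂ * η₃ * φ * ΩSR := Real.sq_sqrt (by positivity)
  have hR : 0 < γR := mul_pos hη₂ hγP
  have hD : 0 < γD := mul_pos hη₃ hγP
  have hγS : 0 < γS := mul_pos hη₁ hγP
  have hφ₂ : 0 < φ₂ := by
    refine add_pos_of_pos_of_nonneg (div_pos ?_ (by positivity)) (by positivity)
    have : 0 < (γD + γR) * ((φ - 1) * (2 * γD + γR) + γD) := by positivity
    linarith
  have hφ₃ : ∀ x, φ₃ x = (c + Real.sqrt (A + B * x)) / K := by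
    intro x
    have harg : (γD ^ 2 * φ ^ 2 + (γD - γR) ^ 2 -
        2 * γD * φ * (γD - γR - 2 * γR * γS * x)) / (γD ^ 2 * γR ^ 2) =
        (A + B * x) / (γP * η₂ * η₃) ^ 2 := by
      simp only [γD, γR, γS, hA, hB]
      field_simp
      ring
    simp only [φ₃]
    rw [harg, Real.sqrt_div' _ (sq_nonneg _), Real.sqrt_sq (by positivity)]
    simp only [γD, γR, hc, hK]
    field_simp
  have hφ₄ : φ₄ = A + B * φ₂ := by
    simp only [φ₄, hA, hB]
    ring
  have hsqrtA : η₂ + η₃ * (φ - 1) ≤ Real.sqrt φ₄ := by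
    refine Real.le_sqrt_of_sq_le ?_
    rw [hφ₄]
    exact le_add_of_nonneg_right (by positivity)
  set y₀ := (c + Real.sqrt φ₄) / K with hy₀
  have hy₀nn : 0 ≤ y₀ := by
    refine div_nonneg ?_ hKpos.le
    have : 0 < η₃ * (φ - 1) := mul_pos hη₃ hφ1
    linarith
  have hsqrt_pos : 0 < Real.sqrt φ₄ := lt_of_lt_of_le (by positivity) hsqrtA
  have hφ₄sq : Real.sqrt φ₄ ^ 2 = A + B * φ₂ := by
    rw [Real.sq_sqrt (Real.sqrt_pos.1 hsqrt_pos).le, hφ₄]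
  set q : ℝ → ℝ := fun y => ((K * y - c) ^ 2 - A) / B with hq
  have hlarge : ∀ y, y₀ < y → Real.sqrt φ₄ < K * y - c := by
    intro y hy
    rw [hy₀, div_lt_iff₀ hKpos] at hy
    linarith
  have hqφ₂ : ∀ y, y₀ < y → φ₂ < q y := by
    intro y hy
    rw [hq, lt_div_iff₀ hBpos]
    have := pow_lt_pow_left₀ (hlarge y hy) hsqrt_pos.le two_ne_zero
    linarith
  have hevent : {ω | φ₂ < gSR ω ∧ gRD ω < φ₃ (gSR ω)} =
      {ω | φ₂ < gSR ω ∧ gRD ω ≤ y₀} ∪ {ω | y₀ < gRD ω ∧ q (gRD ω) < gSR ω} := by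
    ext ω
    simp only [Set.mem_ofPred_eq, Set.mem_union]
    rcases le_or_gt (gRD ω) y₀ with hle | hgt
    · simp only [hle, not_lt.2 hle, and_true, false_and, or_false, and_iff_left_iff_imp]
      intro hlt
      refine hle.trans_lt ?_
      rw [hφ₃, hy₀, hφ₄]
      have := Real.sqrt_lt_sqrt (hφ₄ ▸ (Real.sqrt_pos.1 hsqrt_pos).le)
        (show A + B * φ₂ < A + B * gSR ω by gcongr)
      gcongr
    · have hiff : gRD ω < φ₃ (gSR ω) ↔ q (gRD ω) < gSR ω := by
        rw [hφ₃, lt_div_iff₀ hKpos, hq]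
        beta_reduce
        rw [div_lt_iff₀ hBpos, sub_lt_iff_lt_add', mul_comm (gSR ω), ← Real.lt_sqrt
          (hsqrt_pos.trans (hlarge _ hgt)).le, sub_lt_iff_lt_add', mul_comm]
      simp only [hgt, not_le.2 hgt, and_false, true_and, false_or, hiff, and_iff_right_iff_imp]
      exact (hqφ₂ _ hgt).trans
  have hrect : μ.real {ω | φ₂ < gSR ω ∧ gRD ω ≤ y₀} =
      Real.exp (-φ₂ / ΩSR) * (1 - Real.exp (-y₀ / ΩRD)) := by
    have hinter := hindep.measure_inter_preimage_eq_mul (Set.Ioi φ₂) (Set.Iic y₀)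
      measurableSet_Ioi measurableSet_Iic
    have hcompl : gRD ⁻¹' Set.Iic y₀ = {ω | y₀ < gRD ω}ᶜ := by ext ω; simp
    have hY : μ.real (gRD ⁻¹' Set.Iic y₀) = 1 - Real.exp (-y₀ / ΩRD) := by
      rw [hcompl, probReal_compl_eq_one_sub (measurableSet_lt measurable_const hgRD),
        measureReal_def, hRDexp _ hy₀nn, ENNReal.toReal_ofReal (Real.exp_pos _).le]
    have hX : μ.real (gSR ⁻¹' Set.Ioi φ₂) = Real.exp (-φ₂ / ΩSR) := by
      have := hSRexp _ hφ₂.le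
      rw [measureReal_def, ← ENNReal.toReal_ofReal (Real.exp_pos (-φ₂ / ΩSR)).le, ← this]
      rfl
    rw [← hX, ← hY, measureReal_def, measureReal_def, measureReal_def, ← ENNReal.toReal_mul,
      ← hinter]
    rfl
  have hquad : ∀ y, q y / ΩSR + y / ΩRD =
      (K / (2 * S) * y + (S / (K * ΩRD) - c / (2 * S))) ^ 2 - ψ₆ := by
    intro y
    have hBS : B * ΩSR = 4 * S ^ 2 := by rw [hSsq, hB]; ring
    have hψ₆ : ψ₆ = A / (4 * S ^ 2) - c / (K * ΩRD) + S ^ 2 / (K * ΩRD) ^ 2 := by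
      rw [hSsq]
      simp only [ψ₆, hA, hc, hK]
      field_simp
      ring
    rw [hψ₆, hq, div_div, hBS]
    field_simp
    ring
  have hcurved := measure_lt_and_comp_lt hgSR hgRD hΩRD hRDnn hSRexp hRDexp hindep
    (show Measurable q by fun_prop) hy₀nn (fun y hy => (hφ₂.trans (hqφ₂ y hy)).le)
    (show 0 < K / (2 * S) by positivity) hquad
  have hcoef : Real.exp ψ₆ * (Real.sqrt π / (2 * (K / (2 * S)) * ΩRD)) =
      Real.sqrt π * η₁ * φ * ΩSR * Real.exp ψ₆ / (2 * ΩRD * S) := by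
    rw [hK]
    field_simp
    linear_combination hSsq
  have harg : K / (2 * S) * y₀ + (S / (K * ΩRD) - c / (2 * S)) =
      (η₁ * φ * ΩSR + ΩRD * Real.sqrt φ₄) / (2 * ΩRD * S) := by
    have hSK : S / (K * ΩRD) = η₁ * φ * ΩSR / (2 * ΩRD * S) := by
      rw [div_eq_div_iff (by positivity) (by positivity), hK]
      linear_combination 2 * ΩRD * hSsq
    rw [hSK, hy₀]
    field_simp
    ring
  have hexp : -y₀ / ΩRD = (η₂ - η₃ * φ + η₃ - Real.sqrt φ₄) / (K * ΩRD) := by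
    rw [hy₀, hc]
    field_simp
    ring
  have hdisj : Disjoint {ω | φ₂ < gSR ω ∧ gRD ω ≤ y₀} {ω | y₀ < gRD ω ∧ q (gRD ω) < gSR ω} :=
    Set.disjoint_left.2 fun _ h₁ h₂ => h₂.1.not_ge h₁.2
  have hmeas : MeasurableSet {ω | y₀ < gRD ω ∧ q (gRD ω) < gSR ω} :=
    (measurableSet_lt measurable_const hgRD).inter
      (measurableSet_lt ((show Measurable q by fun_prop).comp hgRD) hgSR)
  rw [← measureReal_def, hevent, measureReal_union hdisj hmeas, hrect, hcurved, hcoef, harg, hexp,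
    add_comm]
end

section
/- System parameters: total SNR γ_P > 0; power allocation factors η₁, η₂, η₃ > 0 with η₁+η₂+η₃ = 1; transmit SNRs γ_S = η₁γ_P, γ_R = η₂γ_P, γ_D = η₃γ_P; average channel gains Ω_SR, Ω_RD > 0; g_SR and g_RD are independent exponentially distributed random variables with means Ω_SR and Ω_RD. For any R_T > 0, setting τ₂ = 2^{2R_T} − 1, the event {(γ_R/(γ_R + γ_D))·min(γ_S g_SR, (γ_R + γ_D) g_RD) ≥ τ₂} equals the event {g_SR ≥ τ₂(γ_R + γ_D)/(γ_R γ_S) and g_RD ≥ τ₂/γ_R}, and its probability equals exp(−(2^{2R_T} − 1)·(η₁Ω_SR + Ω_RD(η₂ + η₃))/(γ_P η₁ η₂ Ω_RD Ω_SR)). -/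
open MeasureTheory Filter Topology in
/-- A random variable with the exponential tail `μ (X > t) = exp (-t / c)` has no atom at `a > 0`,
so the non-strict tail is the same. -/
theorem measure_le_eq_of_measure_lt_eq_exp {α : Type*} [MeasurableSpace α] {μ : Measure α}
    {X : α → ℝ} {c : ℝ}
    (hX : ∀ t : ℝ, 0 ≤ t → μ {ω | t < X ω} = ENNReal.ofReal (Real.exp (-t / c)))
    {a : ℝ} (ha : 0 < a) :
    μ {ω | a ≤ X ω} = ENNReal.ofReal (Real.exp (-a / c)) := by
  apply le_antisymm
  · have hcont : Continuous fun t : ℝ => ENNReal.ofReal (Real.exp (-t / c)) :=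
      ENNReal.continuous_ofReal.comp (by fun_prop)
    refine ge_of_tendsto ((hcont.tendsto a).mono_left (nhdsWithin_le_nhds (s := Set.Iio a))) ?_
    filter_upwards [Ioo_mem_nhdsLT ha] with t ht
    rw [← hX t ht.1.le]
    exact measure_mono fun ω hω => lt_of_lt_of_le ht.2 hω
  · rw [← hX a ha.le]
    exact measure_mono fun ω (hω : a < X ω) => hω.le

/-- The bottleneck SNR exceeds a threshold iff both hops exceed theirs. -/
theorem le_div_mul_min_iff {s r d : ℝ} (hs : 0 < s) (hr : 0 < r) (hd : 0 < d) (τ x y : ℝ) :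
    τ ≤ r / (r + d) * min (s * x) ((r + d) * y) ↔ τ * (r + d) / (r * s) ≤ x ∧ τ / r ≤ y := by
  have hrd : 0 < r + d := add_pos hr hd
  rw [mul_min_of_nonneg _ _ (div_pos hr hrd).le, le_min_iff, div_le_iff₀ (mul_pos hr hs),
    div_le_iff₀ hr, ← mul_assoc (r / (r + d)) (r + d), div_mul_cancel₀ _ hrd.ne', mul_comm r y,
    show r / (r + d) * (s * x) = x * (r * s) / (r + d) by ring, le_div_iff₀ hrd]

open MeasureTheory ProbabilityTheory in
theorem throughput_success_probability {α : Type*} [MeasurableSpace α]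
    (μ : Measure α) [IsProbabilityMeasure μ]
    (gSR gRD : α → ℝ) (hgSR : Measurable gSR) (hgRD : Measurable gRD)
    (γP η₁ η₂ η₃ ΩSR ΩRD : ℝ)
    (hγP : 0 < γP) (hη₁ : 0 < η₁) (hη₂ : 0 < η₂) (hη₃ : 0 < η₃)
    (hsum : η₁ + η₂ + η₃ = 1) (hΩSR : 0 < ΩSR) (hΩRD : 0 < ΩRD)
    (hSRnn : ∀ᵐ ω ∂μ, 0 ≤ gSR ω) (hRDnn : ∀ᵐ ω ∂μ, 0 ≤ gRD ω)
    (hSRexp : ∀ t : ℝ, 0 ≤ t → μ {ω | t < gSR ω} = ENNReal.ofReal (Real.exp (-t / ΩSR)))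
    (hRDexp : ∀ t : ℝ, 0 ≤ t → μ {ω | t < gRD ω} = ENNReal.ofReal (Real.exp (-t / ΩRD)))
    (hindep : IndepFun gSR gRD μ)
    (RT : ℝ) (hRT : 0 < RT) :
    let γS := η₁ * γP
    let γR := η₂ * γP
    let γD := η₃ * γP
    let τ₂ := (2:ℝ) ^ (2 * RT) - 1
    ({ω | τ₂ ≤ (γR / (γR + γD)) * min (γS * gSR ω) ((γR + γD) * gRD ω)}
        = {ω | τ₂ * (γR + γD) / (γR * γS) ≤ gSR ω ∧ τ₂ / γR ≤ gRD ω}) ∧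
    μ {ω | τ₂ ≤ (γR / (γR + γD)) * min (γS * gSR ω) ((γR + γD) * gRD ω)}
      = ENNReal.ofReal (Real.exp (-(((2:ℝ) ^ (2 * RT) - 1) *
          (η₁ * ΩSR + ΩRD * (η₂ + η₃))) / (γP * η₁ * η₂ * ΩRD * ΩSR))) := by
  intro γS γR γD τ₂
  have hS : 0 < γS := mul_pos hη₁ hγP
  have hR : 0 < γR := mul_pos hη₂ hγP
  have hD : 0 < γD := mul_pos hη₃ hγP
  have hτ : 0 < τ₂ := sub_pos.mpr (Real.one_lt_rpow one_lt_two (by positivity))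
  have hset : {ω | τ₂ ≤ (γR / (γR + γD)) * min (γS * gSR ω) ((γR + γD) * gRD ω)}
      = {ω | τ₂ * (γR + γD) / (γR * γS) ≤ gSR ω ∧ τ₂ / γR ≤ gRD ω} :=
    Set.ext fun ω => le_div_mul_min_iff hS hR hD τ₂ (gSR ω) (gRD ω)
  refine ⟨hset, ?_⟩
  have hprod : μ {ω | τ₂ * (γR + γD) / (γR * γS) ≤ gSR ω ∧ τ₂ / γR ≤ gRD ω}
      = μ {ω | τ₂ * (γR + γD) / (γR * γS) ≤ gSR ω} * μ {ω | τ₂ / γR ≤ gRD ω} :=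
    hindep.measure_inter_preimage_eq_mul _ _ measurableSet_Ici measurableSet_Ici
  rw [hset, hprod, measure_le_eq_of_measure_lt_eq_exp hSRexp (by positivity),
    measure_le_eq_of_measure_lt_eq_exp hRDexp (by positivity),
    ← ENNReal.ofReal_mul (Real.exp_nonneg _), ← Real.exp_add]
  congr 2
  change _ = -(τ₂ * (η₁ * ΩSR + ΩRD * (η₂ + η₃))) / (γP * η₁ * η₂ * ΩRD * ΩSR)
  simp only [γS, γR, γD]
  field_simp
  ring
end

section
/- Let K > 0 be a real number and define f : (0, ∞) → ℝ by f(x) = x·exp(−(4^x − 1)·K). Then there exists a unique x* > 0 satisfying K·(ln 4)·x*·4^{x*} = 1, and f attains its strict global maximum on (0, ∞) at x*, i.e., f(x) < f(x*) for all x > 0 with x ≠ x*. -/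
/-- The tangent-line inequality for `x ↦ b ^ x` at `s`. -/
lemma Real.rpow_mul_log_mul_sub_le {b : ℝ} (hb : 0 < b) (s x : ℝ) :
    b ^ s * (Real.log b * (x - s)) ≤ b ^ x - b ^ s := by
  have h := mul_le_mul_of_nonneg_left (Real.add_one_le_exp (Real.log b * (x - s)))
    (Real.rpow_pos_of_pos hb s).le
  rw [← Real.rpow_def_of_pos hb, ← Real.rpow_add hb, add_sub_cancel] at h
  linarith

/-- A positive stationary point of the throughput is its strict global maximizer. -/
lemma throughput_lt_of_stationary {K s x : ℝ} (hK : 0 < K) (hs : 0 < s)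
    (h : K * Real.log 4 * s * (4:ℝ) ^ s = 1) (hxs : x ≠ s) :
    x * Real.exp (-((4:ℝ) ^ x - 1) * K) < s * Real.exp (-((4:ℝ) ^ s - 1) * K) := by
  have tangent : x / s - 1 ≤ K * ((4:ℝ) ^ x - (4:ℝ) ^ s) := by
    calc x / s - 1 = (K * Real.log 4 * s * (4:ℝ) ^ s) * (x / s - 1) := by rw [h, one_mul]
      _ = K * ((4:ℝ) ^ s * (Real.log 4 * (x - s))) := by field_simp
      _ ≤ K * ((4:ℝ) ^ x - (4:ℝ) ^ s) :=
        mul_le_mul_of_nonneg_left (Real.rpow_mul_log_mul_sub_le (by norm_num) s x) hK.le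
  have hne : x / s - 1 ≠ 0 := by
    rwa [sub_ne_zero, Ne, div_eq_one_iff_eq hs.ne']
  have ratio : x / s < Real.exp (K * ((4:ℝ) ^ x - (4:ℝ) ^ s)) := by
    have := Real.add_one_lt_exp hne
    have := Real.exp_le_exp.mpr tangent
    linarith
  rw [div_lt_iff₀ hs] at ratio
  calc x * Real.exp (-((4:ℝ) ^ x - 1) * K)
      < Real.exp (K * ((4:ℝ) ^ x - (4:ℝ) ^ s)) * s * Real.exp (-((4:ℝ) ^ x - 1) * K) :=
        mul_lt_mul_of_pos_right ratio (Real.exp_pos _)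
    _ = s * Real.exp (-((4:ℝ) ^ s - 1) * K) := by
        rw [mul_comm _ s, mul_assoc, ← Real.exp_add]
        ring_nf

lemma exists_pos_stationary {K : ℝ} (hK : 0 < K) :
    ∃ s : ℝ, 0 < s ∧ K * Real.log 4 * s * (4:ℝ) ^ s = 1 := by
  have hc : 0 < K * Real.log 4 := mul_pos hK (Real.log_pos (by norm_num))
  have hM : 0 ≤ (K * Real.log 4)⁻¹ := (inv_pos.mpr hc).le
  have hcont : Continuous fun s : ℝ => K * Real.log 4 * s * (4:ℝ) ^ s :=
    (continuous_const.mul continuous_id).mul (Real.continuous_const_rpow (by norm_num))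
  obtain ⟨s, hs, hs1⟩ := intermediate_value_Icc hM hcont.continuousOn
    (show (1:ℝ) ∈ _ by
      refine ⟨by simp, ?_⟩
      simp only [mul_inv_cancel₀ hc.ne', one_mul]
      exact Real.one_le_rpow (by norm_num) hM)
  refine ⟨s, hs.1.lt_of_ne ?_, hs1⟩
  rintro rfl
  simp at hs1

theorem optimal_secrecy_rate_throughput (K : ℝ) (hK : 0 < K) :
    ∃ xstar : ℝ, 0 < xstar ∧
      K * Real.log 4 * xstar * (4:ℝ) ^ xstar = 1 ∧
      (∀ y : ℝ, 0 < y → K * Real.log 4 * y * (4:ℝ) ^ y = 1 → y = xstar) ∧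
      (∀ x : ℝ, 0 < x → x ≠ xstar →
        x * Real.exp (-((4:ℝ) ^ x - 1) * K) <
          xstar * Real.exp (-((4:ℝ) ^ xstar - 1) * K)) := by
  obtain ⟨s, hs, h⟩ := exists_pos_stationary hK
  refine ⟨s, hs, h, fun y hy hy1 => ?_, fun x _ hxs => throughput_lt_of_stationary hK hs h hxs⟩
  by_contra hne
  exact (throughput_lt_of_stationary hK hs h hne).asymm
    (throughput_lt_of_stationary hK hy hy1 (Ne.symm hne))
end
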